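/- arXiv:2003.13307 — 2 statements merged into one kernel-verified Lean document; each statement's English description precedes it below -/
import Mathlib

section
/- Let H be a finite-dimensional Hopf algebra over an algebraically closed field k with modulus γ, and realize the central monads A₂, A₃ on H-mod as specified, with D = k_{γ⁻¹}. Then λ∈H* is a right monadic cointegral (i.e. an A₂-module morphism 1→A₂(D)) if and only if (λ⊗id)(Δ(h)) = λ(h)·1 for all h∈H, i.e. iff λ is a right cointegral of H; and λ∈H* is a left monadic cointegral (an A₃-module morphism 1→A₃(D)) if and only if (id⊗λ)(Δ(h)) = λ(h)·1 for all h∈H, i.e. iff λ is a left cointegral of H. In particular, every solution of these linear equations is automatically an H-module intertwiner 1→A_i(D). -/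
/-!
STATEMENT 8.
For a finite-dimensional Hopf algebra `H` over an algebraically closed field `k` with
modulus `γ`, and the realization of the central monads `A₂`, `A₃` on `H`-mod as
`A_i(V) = H* ⊗ V` with the actions, units, multiplications and counits as specified,
and `D = k_{γ⁻¹}`:  `λ ∈ H*` is a right (resp. left) monadic cointegral, i.e. an
`A₂`- (resp. `A₃`-) module morphism `1 → A_i(D)` — which amounts to the `H`-module
intertwiner condition together with the monad-module square — if and only if
`(λ ⊗ id)(Δ h) = λ(h)·1` (resp. `(id ⊗ λ)(Δ h) = λ(h)·1`) for all `h`, i.e. iff `λ`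
is a right (resp. left) cointegral of `H`.
-/

open TensorProduct LinearMap

section defs

variable (k : Type) [Field k] (H : Type) [Ring H] [HopfAlgebra k H]

/-- `(Δ ⊗ id)(Δ h) = h₍₁₎ ⊗ h₍₂₎ ⊗ h₍₃₎`. -/
noncomputable def sweedler3 (h : H) : (H ⊗[k] H) ⊗[k] H :=
  (LinearMap.rTensor H (Coalgebra.comul (R := k))) (Coalgebra.comul (R := k) h)

/-- `Σ γl(h₍₂₎) • (S1(h₍₁₎) * a * h₍₃₎)`. -/
noncomputable def twistAct13 (S1 : H →ₗ[k] H) (γl : H →ₗ[k] k) (a h : H) : H :=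
  (LinearMap.mul' k H)
    ((LinearMap.rTensor H ((LinearMap.mulRight k a).comp S1))
      ((LinearMap.rTensor H
          ((TensorProduct.rid k H).toLinearMap.comp (LinearMap.lTensor H γl)))
        (sweedler3 k H h)))

/-- `Σ γl(h₍₂₎) • (S1(h₍₃₎) * a * h₍₁₎)`. -/
noncomputable def twistAct31 (S1 : H →ₗ[k] H) (γl : H →ₗ[k] k) (a h : H) : H :=
  (LinearMap.mul' k H)
    ((LinearMap.rTensor H ((LinearMap.mulRight k a).comp S1))
      ((TensorProduct.comm k H H)
        ((LinearMap.rTensor H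
            ((TensorProduct.rid k H).toLinearMap.comp (LinearMap.lTensor H γl)))
          (sweedler3 k H h))))

end defs

section core

variable {k : Type} [Field k] {H : Type} [Ring H] [Algebra k H]

/-- `(λ ⊗ id)` as a map to `H`. -/
noncomputable def coreF (lam : H →ₗ[k] k) : H ⊗[k] H →ₗ[k] H :=
  (TensorProduct.lid k H).toLinearMap ∘ₗ LinearMap.rTensor H lam

@[simp] lemma coreF_tmul (lam : H →ₗ[k] k) (x y : H) : coreF lam (x ⊗ₜ[k] y) = lam x • y := by
  simp [coreF]

lemma coreF_mul_right (lam : H →ₗ[k] k) (u : H ⊗[k] H) (y : H) :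
    coreF lam (u * (1 ⊗ₜ[k] y)) = coreF lam u * y := by
  induction u with
  | zero => simp
  | add a b ha hb => simp [add_mul, ha, hb]
  | tmul a b => simp

lemma coreF_mul_left (lam : H →ₗ[k] k) (u : H ⊗[k] H) (y : H) :
    coreF lam ((1 ⊗ₜ[k] y) * u) = y * coreF lam u := by
  induction u with
  | zero => simp
  | add a b ha hb => simp [mul_add, ha, hb]
  | tmul a b => simp

variable (Δ : H →ₐ[k] H ⊗[k] H) (ε : H →ₗ[k] k) (S T : H →ₗ[k] H)

/-- The Hopf algebra axioms used in the core argument. -/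
structure CoreHopf : Prop where
  coassoc : ∀ a, TensorProduct.assoc k H H H (Δ.toLinearMap.rTensor H (Δ a))
    = Δ.toLinearMap.lTensor H (Δ a)
  counit_l : ∀ a, ε.rTensor H (Δ a) = 1 ⊗ₜ[k] a
  counit_r : ∀ a, ε.lTensor H (Δ a) = a ⊗ₜ[k] 1
  hS : ∀ a, LinearMap.mul' k H (S.lTensor H (Δ a)) = ε a • (1 : H)
  hT : ∀ a, LinearMap.mul' k H (TensorProduct.comm k H H (T.lTensor H (Δ a))) = ε a • (1 : H)
  hTS : ∀ a, T (S a) = a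
  hST : ∀ a, S (T a) = a

variable {Δ ε S T}

lemma core_K2 (hH : CoreHopf Δ ε S T) (a : H) :
    LinearMap.mul' k (H ⊗[k] H) (TensorProduct.map Δ.toLinearMap
      ((TensorProduct.mk k H H 1) ∘ₗ S) (Δ a)) = a ⊗ₜ[k] 1 := by
  have h1 : ∀ t : H ⊗[k] H, LinearMap.mul' k (H ⊗[k] H) (TensorProduct.map Δ.toLinearMap
      ((TensorProduct.mk k H H 1) ∘ₗ S) t)
      = (LinearMap.mul' k H ∘ₗ S.lTensor H).lTensor H
        (TensorProduct.assoc k H H H (Δ.toLinearMap.rTensor H t)) := by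
    intro t
    induction t with
    | zero => simp
    | add a b ha hb => simp only [map_add, ha, hb]
    | tmul x y =>
      simp only [TensorProduct.map_tmul, LinearMap.mul'_apply, LinearMap.rTensor_tmul,
        LinearMap.comp_apply, TensorProduct.mk_apply, AlgHom.toLinearMap_apply]
      generalize Δ x = u
      induction u with
      | zero => simp
      | add a b ha hb => simp only [add_mul, TensorProduct.add_tmul, map_add, ha, hb]
      | tmul p q => simp
  rw [h1, hH.coassoc, ← LinearMap.comp_apply, ← LinearMap.lTensor_comp]
  have h2 : (LinearMap.mul' k H ∘ₗ S.lTensor H) ∘ₗ Δ.toLinearMap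
      = (LinearMap.toSpanSingleton k H 1) ∘ₗ ε := by
    ext a; simp [hH.hS]
  rw [h2, LinearMap.lTensor_comp, LinearMap.comp_apply, hH.counit_r]
  simp

lemma core_K1 (hH : CoreHopf Δ ε S T) (a : H) :
    LinearMap.mul' k (H ⊗[k] H) (TensorProduct.comm k _ _ (TensorProduct.map Δ.toLinearMap
      ((TensorProduct.mk k H H 1) ∘ₗ T) (Δ a))) = a ⊗ₜ[k] 1 := by
  have h1 : ∀ t : H ⊗[k] H, LinearMap.mul' k (H ⊗[k] H) (TensorProduct.comm k _ _
      (TensorProduct.map Δ.toLinearMap ((TensorProduct.mk k H H 1) ∘ₗ T) t))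
      = (LinearMap.mul' k H ∘ₗ (TensorProduct.comm k H H).toLinearMap ∘ₗ T.lTensor H).lTensor H
        (TensorProduct.assoc k H H H (Δ.toLinearMap.rTensor H t)) := by
    intro t
    induction t with
    | zero => simp
    | add a b ha hb => simp only [map_add, ha, hb]
    | tmul x y =>
      simp only [TensorProduct.map_tmul, LinearMap.mul'_apply, LinearMap.rTensor_tmul,
        LinearMap.comp_apply, TensorProduct.mk_apply, AlgHom.toLinearMap_apply,
        TensorProduct.comm_tmul]
      generalize Δ x = u
      induction u with
      | zero => simp
      | add a b ha hb => simp only [mul_add, TensorProduct.add_tmul, map_add, ha, hb]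
      | tmul p q => simp
  rw [h1, hH.coassoc, ← LinearMap.comp_apply, ← LinearMap.lTensor_comp]
  have h2 : (LinearMap.mul' k H ∘ₗ (TensorProduct.comm k H H).toLinearMap ∘ₗ T.lTensor H)
      ∘ₗ Δ.toLinearMap = (LinearMap.toSpanSingleton k H 1) ∘ₗ ε := by
    ext a; simp [hH.hT]
  rw [h2, LinearMap.lTensor_comp, LinearMap.comp_apply, hH.counit_r]
  simp

variable {lam : H →ₗ[k] k}

lemma core_I1 (hH : CoreHopf Δ ε S T) (hl : ∀ h, coreF lam (Δ h) = lam h • (1 : H)) (a b : H) :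
    coreF lam ((a ⊗ₜ[k] 1) * Δ b) =
      TensorProduct.lid k H (TensorProduct.map (lam ∘ₗ LinearMap.mulRight k b) T (Δ a)) := by
  rw [← core_K1 hH a]
  generalize Δ a = t
  induction t with
  | zero => simp
  | add a b ha hb => simp only [map_add, add_mul, ha, hb]
  | tmul x y =>
    simp [mul_assoc, coreF_mul_left, ← map_mul, hl]

lemma core_I2 (hH : CoreHopf Δ ε S T) (hl : ∀ h, coreF lam (Δ h) = lam h • (1 : H))
    (c : H) (γ : H →ₐ[k] k) (hγ : ∀ h : H, c * h = γ h • c) (a : H) :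
    coreF lam (Δ c * (a ⊗ₜ[k] 1)) =
      lam c • TensorProduct.lid k H (TensorProduct.map γ.toLinearMap S (Δ a)) := by
  rw [← core_K2 hH a]
  generalize Δ a = t
  induction t with
  | zero => simp
  | add a b ha hb => simp only [map_add, mul_add, smul_add, ha, hb]
  | tmul x y =>
    simp only [TensorProduct.map_tmul, LinearMap.mul'_apply, LinearMap.comp_apply,
      TensorProduct.mk_apply, AlgHom.toLinearMap_apply, ← mul_assoc, coreF_mul_right, ← map_mul,
      hl, hγ]
    simp [smul_smul, mul_comm]

lemma core_I3 (hH : CoreHopf Δ ε S T) (hl : ∀ h, coreF lam (Δ h) = lam h • (1 : H))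
    (c : H) (hc : ∀ h : H, h * c = ε h • c) (a : H) :
    coreF lam ((a ⊗ₜ[k] 1) * Δ c) = lam c • T a := by
  rw [core_I1 hH hl]
  have : lam ∘ₗ LinearMap.mulRight k c = lam c • ε := by
    ext x; simp [hc, mul_comm]
  rw [this]
  have h2 : ∀ t : H ⊗[k] H, TensorProduct.lid k H (TensorProduct.map (lam c • ε) T t)
      = lam c • T (TensorProduct.lid k H (ε.rTensor H t)) := by
    intro t
    induction t with
    | zero => simp
    | add a b ha hb => simp only [map_add, smul_add, ha, hb]
    | tmul x y => simp [smul_smul]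
  rw [h2, hH.counit_l]; simp

/-- slice: if `(λ(h ·) ⊗ id) u = 0` for all `h` then `u = Σ yᵢ ⊗ eᵢ` with `yᵢ` in the radical. -/
lemma core_slice (lam : H →ₗ[k] k) (u : H ⊗[k] H)
    (hu : ∀ h : H, coreF lam ((h ⊗ₜ[k] 1) * u) = 0) :
    ∃ (ι : Type) (s : Finset ι) (y e : ι → H), u = ∑ i ∈ s, y i ⊗ₜ[k] e i ∧
      ∀ i ∈ s, ∀ h, lam (h * y i) = 0 := by
  classical
  let B := Module.Basis.ofVectorSpace k H
  obtain ⟨b, hb⟩ := TensorProduct.eq_repr_basis_right B u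
  refine ⟨_, b.support, b, B, hb.symm, ?_⟩
  intro i hi h
  have := hu h
  rw [← hb, Finsupp.sum, Finset.mul_sum, map_sum] at this
  simp only [Algebra.TensorProduct.tmul_mul_tmul, one_mul, coreF_tmul] at this
  exact linearIndependent_iff'.1 B.linearIndependent b.support (fun i => lam (h * b i)) this i hi

lemma core_nondeg (hH : CoreHopf Δ ε S T) (hl : ∀ h, coreF lam (Δ h) = lam h • (1 : H))
    (hne : lam ≠ 0) (x : H) (hx : ∀ h, lam (h * x) = 0) : x = 0 := by
  have hsl : ∀ x : H, (∀ h, lam (h * x) = 0) → ∀ h, coreF lam ((h ⊗ₜ[k] 1) * Δ x) = 0 := by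
    intro x hx h
    rw [core_I1 hH hl]
    have : lam ∘ₗ LinearMap.mulRight k x = 0 := by
      ext y; simp [hx]
    rw [this]; simp
  have heps : ∀ x : H, (∀ h, lam (h * x) = 0) → ε x = 0 := by
    intro x hx
    obtain ⟨ι, s, y, e, hu, hy⟩ := core_slice lam (Δ x) (hsl x hx)
    by_contra h0
    apply hne
    ext h
    have := hH.hT x
    rw [hu] at this
    simp only [map_sum, LinearMap.lTensor_tmul, TensorProduct.comm_tmul, LinearMap.mul'_apply]
      at this
    have h3 := congrArg (fun z => lam (h * z)) this
    simp only [Finset.mul_sum, map_sum, ← mul_assoc] at h3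
    rw [Finset.sum_eq_zero (fun i hi => hy i hi _)] at h3
    simpa [h0] using h3.symm
  obtain ⟨ι, s, y, e, hu, hy⟩ := core_slice lam (Δ x) (hsl x hx)
  have := hH.counit_l x
  rw [hu] at this
  simp only [map_sum, LinearMap.rTensor_tmul] at this
  rw [Finset.sum_eq_zero (fun i hi => by rw [heps _ (hy i hi), TensorProduct.zero_tmul])] at this
  simpa using (congrArg (TensorProduct.lid k H) this).symm

lemma core_ne (hH : CoreHopf Δ ε S T) (hl : ∀ h, coreF lam (Δ h) = lam h • (1 : H))
    (hne : lam ≠ 0) (c : H) (hc0 : c ≠ 0) (hc : ∀ h : H, h * c = ε h • c) : lam c ≠ 0 := by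
  intro h0
  obtain ⟨ι, s, y, e, hu, hy⟩ := core_slice lam (Δ c) (fun h => by
    rw [core_I3 hH hl c hc, h0, zero_smul])
  have h1 : Δ c = 0 := by
    rw [hu]
    exact Finset.sum_eq_zero (fun i hi => by
      rw [core_nondeg hH hl hne _ (hy i hi), TensorProduct.zero_tmul])
  have := hH.counit_l c
  rw [h1] at this
  exact hc0 (by simpa using (congrArg (TensorProduct.lid k H) this).symm)

lemma core_surj [FiniteDimensional k H] (hH : CoreHopf Δ ε S T)
    (hl : ∀ h, coreF lam (Δ h) = lam h • (1 : H)) (hne : lam ≠ 0) (μ : H →ₗ[k] k) :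
    ∃ g : H, ∀ a, μ a = lam (g * a) := by
  let L : H →ₗ[k] Module.Dual k H := ((LinearMap.mul k H).compr₂ lam).flip
  let R : H →ₗ[k] Module.Dual k H := (LinearMap.mul k H).compr₂ lam
  have hLi : Function.Injective L := by
    rw [injective_iff_map_eq_zero]
    intro x hx
    exact core_nondeg hH hl hne x (fun h => by simpa [L] using LinearMap.congr_fun hx h)
  have hfr : Module.finrank k H = Module.finrank k (Module.Dual k H) :=
    (Subspace.dual_finrank_eq).symm
  have hLs : Function.Surjective L := (LinearMap.injective_iff_surjective_of_finrank_eq_finrank hfr).1 hLi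
  have hRi : Function.Injective R := by
    rw [injective_iff_map_eq_zero]
    intro g hg
    rw [← Module.forall_dual_apply_eq_zero_iff k]
    intro φ
    obtain ⟨x, rfl⟩ := hLs φ
    simpa [L, R] using LinearMap.congr_fun hg x
  obtain ⟨g, hg⟩ := (LinearMap.injective_iff_surjective_of_finrank_eq_finrank hfr).1 hRi μ
  exact ⟨g, fun a => by rw [← hg]; simp [R]⟩

/-- The Nakayama-type identity `λ(S²(h) a) = Σ γ'(h₁) λ(a h₂)`. -/
lemma core_nakayama [FiniteDimensional k H] (hH : CoreHopf Δ ε S T)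
    (hl : ∀ h, coreF lam (Δ h) = lam h • (1 : H))
    (c : H) (hc0 : c ≠ 0) (hc : ∀ h : H, h * c = ε h • c)
    (γ : H →ₐ[k] k) (hγ : ∀ h : H, c * h = γ h • c) (γ' : H →ₗ[k] k)
    (hγ' : ∀ x, LinearMap.mul' k k (TensorProduct.map γ' γ.toLinearMap (Δ x)) = ε x)
    (a h : H) :
    lam (S (S h) * a) = lam (a * coreF γ' (Δ h)) := by
  by_cases hne : lam = 0
  · simp [hne]
  have hlc := core_ne hH hl hne c hc0 hc
  set h' := coreF γ' (Δ h) with hh'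
  have hB : TensorProduct.lid k H (TensorProduct.map γ.toLinearMap S (Δ h')) = S h := by
    have h1 : ∀ t : H ⊗[k] H,
        TensorProduct.lid k H (TensorProduct.map γ.toLinearMap S (Δ (coreF γ' t)))
        = TensorProduct.lid k H (TensorProduct.lid k _ (TensorProduct.map γ'
          (TensorProduct.map γ.toLinearMap S) (Δ.toLinearMap.lTensor H t))) := by
      intro t
      induction t with
      | zero => simp
      | add a b ha hb => simp only [map_add, ha, hb]
      | tmul x y => simp
    have h2 : ∀ t : H ⊗[k] H,
        TensorProduct.lid k H (TensorProduct.lid k _ (TensorProduct.map γ'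
          (TensorProduct.map γ.toLinearMap S) (TensorProduct.assoc k H H H
            (Δ.toLinearMap.rTensor H t))))
        = S (TensorProduct.lid k H (ε.rTensor H t)) := by
      intro t
      induction t with
      | zero => simp
      | add a b ha hb => simp only [map_add, ha, hb]
      | tmul x y =>
        simp only [LinearMap.rTensor_tmul, AlgHom.toLinearMap_apply, TensorProduct.lid_tmul,
          map_smul, ← hγ' x]
        generalize Δ x = u
        induction u with
        | zero => simp
        | add a b ha hb => simp only [TensorProduct.add_tmul, map_add, add_smul, ha, hb]
        | tmul p q => simp [smul_smul]
    rw [hh', h1, ← hH.coassoc, h2, hH.counit_l]; simp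
  have e1 := core_I3 hH hl c hc (S (S h))
  rw [hH.hTS] at e1
  have e2 := core_I2 hH hl c γ hγ h'
  rw [hB] at e2
  obtain ⟨g, hg⟩ := core_surj hH hl hne
    (lam ∘ₗ LinearMap.mulLeft k (S (S h)) - lam ∘ₗ LinearMap.mulRight k h')
  have e3 := core_I3 hH hl c hc g
  have h3 : ∀ u : H ⊗[k] H, coreF lam ((g ⊗ₜ[k] 1) * u)
      = coreF lam ((S (S h) ⊗ₜ[k] 1) * u) - coreF lam (u * (h' ⊗ₜ[k] 1)) := by
    intro u
    induction u with
    | zero => simp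
    | add a b ha hb => simp only [mul_add, add_mul, map_add, ha, hb]; abel
    | tmul p q =>
      have := hg p
      simp at this
      simp [← this, sub_smul]
  rw [h3, e1, e2, sub_self] at e3
  have hTg : T g = 0 := (smul_eq_zero.1 e3.symm).resolve_left hlc
  have hg0 : g = 0 := by rw [← hH.hST g, hTg, map_zero]
  have := hg a
  simp [hg0] at this
  exact sub_eq_zero.1 this

end core

section apply

variable (k : Type) [Field k] (H : Type) [Ring H] [HopfAlgebra k H]

open HopfAlgebra Coalgebra

lemma core_of_hopf (Sinv : H →ₗ[k] H)
    (hSinv₁ : ∀ x : H, Sinv (HopfAlgebra.antipode (R := k) x) = x)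
    (hSinv₂ : ∀ x : H, HopfAlgebra.antipode (R := k) (Sinv x) = x) :
    CoreHopf (Bialgebra.comulAlgHom k H) (counit (R := k)) (antipode k) Sinv where
  coassoc a := coassoc_apply a
  counit_l a := rTensor_counit_comul a
  counit_r a := lTensor_counit_comul a
  hS a := by
    rw [← Algebra.algebraMap_eq_smul_one]
    exact mul_antipode_lTensor_comul_apply a
  hT a := by
    have hinj : Function.Injective (antipode k (A := H)) :=
      Function.LeftInverse.injective hSinv₁
    apply hinj
    have h1 : ∀ t : H ⊗[k] H, antipode k (LinearMap.mul' k H (TensorProduct.comm k H H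
        (Sinv.lTensor H t))) = LinearMap.mul' k H ((antipode k).rTensor H t) := by
      intro t
      induction t with
      | zero => simp
      | add a b ha hb => simp only [map_add, ha, hb]
      | tmul x y => simp [antipode_mul_antidistrib, hSinv₂]
    rw [h1, map_smul, antipode_one, ← Algebra.algebraMap_eq_smul_one]
    exact mul_antipode_rTensor_comul_apply a
  hTS := hSinv₁
  hST := hSinv₂

/-- co-opposite comultiplication. -/
noncomputable def copComul : H →ₐ[k] H ⊗[k] H :=
  (Algebra.TensorProduct.comm k H H).toAlgHom.comp (Bialgebra.comulAlgHom k H)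

lemma copComul_apply (a : H) :
    copComul k H a = TensorProduct.comm k H H (comul (R := k) a) := rfl

lemma core_of_cop (Sinv : H →ₗ[k] H)
    (hSinv₁ : ∀ x : H, Sinv (HopfAlgebra.antipode (R := k) x) = x)
    (hSinv₂ : ∀ x : H, HopfAlgebra.antipode (R := k) (Sinv x) = x) :
    CoreHopf (copComul k H) (counit (R := k)) Sinv (antipode k) where
  coassoc a := by
    let rev : H ⊗[k] (H ⊗[k] H) →ₗ[k] H ⊗[k] (H ⊗[k] H) :=
      (TensorProduct.assoc k H H H).toLinearMap ∘ₗ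
        (TensorProduct.comm k H (H ⊗[k] H)).toLinearMap ∘ₗ
          (TensorProduct.comm k H H).toLinearMap.lTensor H
    have h1 : ∀ t : H ⊗[k] H, TensorProduct.assoc k H H H
        ((copComul k H).toLinearMap.rTensor H (TensorProduct.comm k H H t))
        = rev ((comul (R := k)).lTensor H t) := by
      intro t
      induction t with
      | zero => simp
      | add a b ha hb => simp only [map_add, ha, hb]
      | tmul x y => simp [rev, copComul_apply]
    have h2 : ∀ t : H ⊗[k] H, (copComul k H).toLinearMap.lTensor H (TensorProduct.comm k H H t)
        = rev (TensorProduct.assoc k H H H ((comul (R := k)).rTensor H t)) := by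
      intro t
      induction t with
      | zero => simp
      | add a b ha hb => simp only [map_add, ha, hb]
      | tmul x y =>
        simp only [TensorProduct.comm_tmul, LinearMap.rTensor_tmul, LinearMap.lTensor_tmul,
          AlgHom.toLinearMap_apply, copComul_apply]
        generalize comul (R := k) x = u
        induction u with
        | zero => simp
        | add a b ha hb =>
          simp only [TensorProduct.tmul_add, TensorProduct.add_tmul, map_add, ha, hb]
        | tmul p q => simp [rev]
    rw [copComul_apply, h1, h2, coassoc_apply]
  counit_l a := by
    have h1 : ∀ t : H ⊗[k] H, (counit (R := k)).rTensor H (TensorProduct.comm k H H t)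
        = TensorProduct.comm k H k ((counit (R := k)).lTensor H t) := by
      intro t
      induction t with
      | zero => simp
      | add a b ha hb => simp only [map_add, ha, hb]
      | tmul x y => simp
    rw [copComul_apply, h1, lTensor_counit_comul]; simp
  counit_r a := by
    have h1 : ∀ t : H ⊗[k] H, (counit (R := k)).lTensor H (TensorProduct.comm k H H t)
        = TensorProduct.comm k k H ((counit (R := k)).rTensor H t) := by
      intro t
      induction t with
      | zero => simp
      | add a b ha hb => simp only [map_add, ha, hb]
      | tmul x y => simp
    rw [copComul_apply, h1, rTensor_counit_comul]; simp
  hS a := by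
    have hinj : Function.Injective (antipode k (A := H)) :=
      Function.LeftInverse.injective hSinv₁
    apply hinj
    have h1 : ∀ t : H ⊗[k] H, antipode k (LinearMap.mul' k H 
        (Sinv.lTensor H (TensorProduct.comm k H H t)))
          = LinearMap.mul' k H ((antipode k).lTensor H t) := by
      intro t
      induction t with
      | zero => simp
      | add a b ha hb => simp only [map_add, ha, hb]
      | tmul x y => simp [antipode_mul_antidistrib, hSinv₂]
    rw [copComul_apply, h1, map_smul, antipode_one, ← Algebra.algebraMap_eq_smul_one]
    exact mul_antipode_lTensor_comul_apply a
  hT a := by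
    have h1 : ∀ t : H ⊗[k] H, LinearMap.mul' k H (TensorProduct.comm k H H
        ((antipode k).lTensor H (TensorProduct.comm k H H t)))
          = LinearMap.mul' k H ((antipode k).rTensor H t) := by
      intro t
      induction t with
      | zero => simp
      | add a b ha hb => simp only [map_add, ha, hb]
      | tmul x y => simp
    rw [copComul_apply, h1, ← Algebra.algebraMap_eq_smul_one]
    exact mul_antipode_rTensor_comul_apply a
  hTS := hSinv₂
  hST := hSinv₁

lemma right_intertwiner [FiniteDimensional k H] (Sinv : H →ₗ[k] H)
    (hSinv₁ : ∀ x : H, Sinv (HopfAlgebra.antipode (R := k) x) = x)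
    (hSinv₂ : ∀ x : H, HopfAlgebra.antipode (R := k) (Sinv x) = x)
    (c : H) (hc_ne : c ≠ 0)
    (hc : ∀ h : H, h * c = (Coalgebra.counit (R := k) h) • c)
    (γ : H →ₐ[k] k) (hγ : ∀ h : H, c * h = γ h • c)
    (lam : H →ₗ[k] k)
    (hl : ∀ h : H, (TensorProduct.lid k H)
      ((LinearMap.rTensor H lam) (Coalgebra.comul (R := k) h)) = lam h • (1 : H)) (a h : H) :
    lam (twistAct13 k H (HopfAlgebra.antipode (R := k))
        (γ.toLinearMap.comp (HopfAlgebra.antipode (R := k))) a h)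
      = (Coalgebra.counit (R := k) h) * lam a := by
  have hγ' : ∀ x, LinearMap.mul' k k (TensorProduct.map (γ.toLinearMap.comp (antipode k))
      γ.toLinearMap (Bialgebra.comulAlgHom k H x)) = counit (R := k) x := by
    intro x
    have h1 : ∀ t : H ⊗[k] H, LinearMap.mul' k k (TensorProduct.map
        (γ.toLinearMap.comp (antipode k)) γ.toLinearMap t)
        = γ (LinearMap.mul' k H ((antipode k).rTensor H t)) := by
      intro t
      induction t with
      | zero => simp
      | add a b ha hb => simp only [map_add, ha, hb]
      | tmul x y => simp
    rw [h1, Bialgebra.comulAlgHom_apply, mul_antipode_rTensor_comul_apply]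
    simp
  have hN := core_nakayama (core_of_hopf k H Sinv hSinv₁ hSinv₂) (lam := lam) hl c hc_ne hc γ hγ
    (γ.toLinearMap.comp (antipode k)) hγ'
  have h1 : ∀ t : H ⊗[k] H, lam ((LinearMap.mul' k H)
      ((LinearMap.rTensor H ((LinearMap.mulRight k a).comp (antipode k)))
      ((LinearMap.rTensor H
          ((TensorProduct.rid k H).toLinearMap.comp
            (LinearMap.lTensor H (γ.toLinearMap.comp (antipode k)))))
        ((TensorProduct.assoc k H H H).symm ((comul (R := k)).lTensor H t)))))
      = lam (antipode k (LinearMap.mul' k H ((antipode k).lTensor H t)) * a) := by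
    intro t
    induction t with
    | zero => simp
    | add a b ha hb => simp only [map_add, add_mul, ha, hb]
    | tmul x y =>
      have := hN (antipode k x * a) y
      simp only [LinearMap.lTensor_tmul, LinearMap.mul'_apply, antipode_mul_antidistrib,
        mul_assoc, this, Bialgebra.comulAlgHom_apply]
      congr 1
      generalize comul (R := k) y = u
      induction u with
      | zero => simp
      | add a b ha hb =>
        simp only [TensorProduct.tmul_add, mul_add, map_add, ha, hb]
      | tmul p q => simp [mul_assoc, TensorProduct.smul_tmul']
  unfold twistAct13 sweedler3
  rw [← coassoc_symm_apply, h1, mul_antipode_lTensor_comul_apply]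
  simp [Algebra.algebraMap_eq_smul_one]

lemma left_intertwiner [FiniteDimensional k H] (Sinv : H →ₗ[k] H)
    (hSinv₁ : ∀ x : H, Sinv (HopfAlgebra.antipode (R := k) x) = x)
    (hSinv₂ : ∀ x : H, HopfAlgebra.antipode (R := k) (Sinv x) = x)
    (c : H) (hc_ne : c ≠ 0)
    (hc : ∀ h : H, h * c = (Coalgebra.counit (R := k) h) • c)
    (γ : H →ₐ[k] k) (hγ : ∀ h : H, c * h = γ h • c)
    (lam : H →ₗ[k] k)
    (hl : ∀ h : H, (TensorProduct.rid k H)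
      ((LinearMap.lTensor H lam) (Coalgebra.comul (R := k) h)) = lam h • (1 : H)) (a h : H) :
    lam (twistAct31 k H Sinv
        (γ.toLinearMap.comp (HopfAlgebra.antipode (R := k))) a h)
      = (Coalgebra.counit (R := k) h) * lam a := by
  have hanti : ∀ x y : H, Sinv (x * y) = Sinv y * Sinv x := by
    intro x y
    have hinj : Function.Injective (antipode k (A := H)) :=
      Function.LeftInverse.injective hSinv₁
    apply hinj
    rw [antipode_mul_antidistrib, hSinv₂, hSinv₂, hSinv₂]
  have hSinv_one : Sinv 1 = 1 := by
    have := hSinv₁ 1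
    rwa [antipode_one] at this
  have hcop := core_of_cop k H Sinv hSinv₁ hSinv₂
  have hγ' : ∀ x, LinearMap.mul' k k (TensorProduct.map (γ.toLinearMap.comp (antipode k))
      γ.toLinearMap (copComul k H x)) = counit (R := k) x := by
    intro x
    have h1 : ∀ t : H ⊗[k] H, LinearMap.mul' k k (TensorProduct.map
        (γ.toLinearMap.comp (antipode k)) γ.toLinearMap (TensorProduct.comm k H H t))
        = γ (LinearMap.mul' k H ((antipode k).lTensor H t)) := by
      intro t
      induction t with
      | zero => simp
      | add a b ha hb => simp only [map_add, ha, hb]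
      | tmul x y => simp [mul_comm]
    rw [copComul_apply, h1, mul_antipode_lTensor_comul_apply]
    simp
  have hF : ∀ (f : H →ₗ[k] k) (t : H ⊗[k] H), coreF f (TensorProduct.comm k H H t)
      = TensorProduct.rid k H (f.lTensor H t) := by
    intro f t
    induction t with
    | zero => simp
    | add a b ha hb => simp only [map_add, ha, hb]
    | tmul x y => simp
  have hN := core_nakayama hcop (lam := lam)
    (fun h => by rw [copComul_apply, hF, hl]) c hc_ne hc γ hγ
    (γ.toLinearMap.comp (antipode k)) hγ'
  have h1 : ∀ t : H ⊗[k] H, lam ((LinearMap.mul' k H)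
      ((LinearMap.rTensor H ((LinearMap.mulRight k a).comp Sinv))
      ((TensorProduct.comm k H H)
      ((LinearMap.rTensor H
          ((TensorProduct.rid k H).toLinearMap.comp
            (LinearMap.lTensor H (γ.toLinearMap.comp (antipode k)))))
        ((comul (R := k)).rTensor H t)))))
      = lam (Sinv (LinearMap.mul' k H (Sinv.lTensor H (TensorProduct.comm k H H t))) * a) := by
    intro t
    induction t with
    | zero => simp
    | add a b ha hb => simp only [map_add, add_mul, ha, hb]
    | tmul x y =>
      have := hN (Sinv y * a) x
      rw [copComul_apply, hF] at this
      simp only [LinearMap.lTensor_tmul, LinearMap.mul'_apply, hanti, TensorProduct.comm_tmul,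
        mul_assoc, this, LinearMap.rTensor_tmul, LinearMap.comp_apply, LinearMap.mulRight_apply,
        LinearEquiv.coe_coe]
  unfold twistAct31 sweedler3
  rw [h1, ← copComul_apply, hcop.hS]
  simp [hSinv_one]

end apply

theorem stmt_8
    (k : Type) [Field k] [IsAlgClosed k]
    (H : Type) [Ring H] [HopfAlgebra k H] [FiniteDimensional k H]
    -- the antipode is (automatically) invertible; `Sinv` is its inverse
    (Sinv : H →ₗ[k] H)
    (hSinv₁ : ∀ x : H, Sinv (HopfAlgebra.antipode (R := k) x) = x)
    (hSinv₂ : ∀ x : H, HopfAlgebra.antipode (R := k) (Sinv x) = x)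
    -- `c` is a non-zero left integral and `γ` the modulus of `H`
    (c : H) (hc_ne : c ≠ 0)
    (hc_left_integral : ∀ h : H, h * c = (Coalgebra.counit (R := k) h) • c)
    (γ : H →ₐ[k] k) (hγ : ∀ h : H, c * h = γ h • c)
    (lam : H →ₗ[k] k) :
    -- Part 1: right monadic cointegral for A₂ ↔ right cointegral
    (((∀ a h : H,
          lam (twistAct13 k H (HopfAlgebra.antipode (R := k))
                (γ.toLinearMap.comp (HopfAlgebra.antipode (R := k))) a h)
            = (Coalgebra.counit (R := k) h) * lam a) ∧
        (∀ (f : Module.Dual k H) (x : H),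
          (TensorProduct.lid k k) ((TensorProduct.map lam f) (Coalgebra.comul (R := k) x))
            = f 1 * lam x))
      ↔ (∀ h : H,
          (TensorProduct.lid k H)
            ((LinearMap.rTensor H lam) (Coalgebra.comul (R := k) h)) = lam h • (1 : H)))
    ∧
    -- Part 2: left monadic cointegral for A₃ ↔ left cointegral
    (((∀ a h : H,
          lam (twistAct31 k H Sinv
                (γ.toLinearMap.comp (HopfAlgebra.antipode (R := k))) a h)
            = (Coalgebra.counit (R := k) h) * lam a) ∧
        (∀ (f : Module.Dual k H) (x : H),
          (TensorProduct.lid k k) ((TensorProduct.map f lam) (Coalgebra.comul (R := k) x))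
            = f 1 * lam x))
      ↔ (∀ h : H,
          (TensorProduct.rid k H)
            ((LinearMap.lTensor H lam) (Coalgebra.comul (R := k) h)) = lam h • (1 : H))) := by
  refine ⟨⟨fun ⟨_, h2⟩ h => ?_, fun hl => ⟨?_, fun f x => ?_⟩⟩,
    ⟨fun ⟨_, h2⟩ h => ?_, fun hl => ⟨?_, fun f x => ?_⟩⟩⟩
  · have key : ∀ (f : Module.Dual k H) (t : H ⊗[k] H),
        f (TensorProduct.lid k H (LinearMap.rTensor H lam t))
        = TensorProduct.lid k k (TensorProduct.map lam f t) := by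
      intro f t
      induction t with
      | zero => simp
      | add a b ha hb => simp only [map_add, ha, hb]
      | tmul x y => simp
    rw [← sub_eq_zero, ← Module.forall_dual_apply_eq_zero_iff k]
    intro f
    rw [map_sub, key, h2, map_smul, smul_eq_mul, mul_comm, sub_self]
  · exact right_intertwiner k H Sinv hSinv₁ hSinv₂ c hc_ne hc_left_integral γ hγ lam hl
  · have key : ∀ (t : H ⊗[k] H),
        f (TensorProduct.lid k H (LinearMap.rTensor H lam t))
        = TensorProduct.lid k k (TensorProduct.map lam f t) := by
      intro t
      induction t with
      | zero => simp
      | add a b ha hb => simp only [map_add, ha, hb]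
      | tmul x y => simp
    rw [← key, hl, map_smul, smul_eq_mul, mul_comm]
  · have key : ∀ (f : Module.Dual k H) (t : H ⊗[k] H),
        f (TensorProduct.rid k H (LinearMap.lTensor H lam t))
        = TensorProduct.lid k k (TensorProduct.map f lam t) := by
      intro f t
      induction t with
      | zero => simp
      | add a b ha hb => simp only [map_add, ha, hb]
      | tmul x y => simp [mul_comm]
    rw [← sub_eq_zero, ← Module.forall_dual_apply_eq_zero_iff k]
    intro f
    rw [map_sub, key, h2, map_smul, smul_eq_mul, mul_comm, sub_self]
  · exact left_intertwiner k H Sinv hSinv₁ hSinv₂ c hc_ne hc_left_integral γ hγ lam hl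
  · have key : ∀ (t : H ⊗[k] H),
        f (TensorProduct.rid k H (LinearMap.lTensor H lam t))
        = TensorProduct.lid k k (TensorProduct.map f lam t) := by
      intro t
      induction t with
      | zero => simp
      | add a b ha hb => simp only [map_add, ha, hb]
      | tmul x y => simp [mul_comm]
    rw [← key, hl, map_smul, smul_eq_mul, mul_comm]
end

section
/- Let (H,g) be a finite-dimensional pivotal Hopf algebra over an algebraically closed field k with modulus γ, and realize the central monads A₁, A₄ on H-mod as specified, with D = k_{γ⁻¹}. Then λ∈H* is a right D-symmetrised monadic cointegral (an A₁-module morphism 1→A₁(D)) if and only if (λ⊗id)(Δ(h)) = λ(h)·g⁻¹ for all h∈H, i.e. iff λ is a right γ-symmetrised cointegral of H; and λ∈H* is a left D-symmetrised monadic cointegral (an A₄-module morphism 1→A₄(D)) if and only if (id⊗λ)(Δ(h)) = λ(h)·g for all h∈H, i.e. iff λ is a left γ-symmetrised cointegral of H. In particular, solutions of these linear equations are automatically H-module intertwiners. -/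
/-!
STATEMENT 9.
For a finite-dimensional pivotal Hopf algebra `(H, g)` over an algebraically closed
field `k` with modulus `γ`, and the realization of the central monads `A₁`, `A₄` on
`H`-mod as specified (with `D = k_{γ⁻¹}`):  `λ ∈ H*` is a right (resp. left)
`D`-symmetrised monadic cointegral — i.e. an `A₁`- (resp. `A₄`-) module morphism
`1 → A_i(D)`, which amounts to the `H`-intertwiner condition plus the monad-module
square — if and only if `(λ ⊗ id)(Δ h) = λ(h)·g⁻¹` (resp. `(id ⊗ λ)(Δ h) = λ(h)·g`)
for all `h`, i.e. iff `λ` is a right (resp. left) `γ`-symmetrised cointegral of `H`.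
-/

open TensorProduct LinearMap

open Coalgebra WithConv HopfAlgebra MulOpposite

section helpers

variable {k : Type} [Field k] {H : Type} [Ring H] [HopfAlgebra k H]

section convgen
variable {A : Type} [Ring A] [Algebra k A]

lemma comp_conv_left (C : A) (φ ψ : H →ₗ[k] A) :
    toConv (mulLeft k C ∘ₗ (toConv φ * toConv ψ).ofConv)
      = toConv (mulLeft k C ∘ₗ φ) * toConv ψ := by
  ext x
  simp [(ℛ k x).convMul_apply, Finset.mul_sum, mul_assoc]

lemma comp_conv_right (C : A) (φ ψ : H →ₗ[k] A) :
    toConv (mulRight k C ∘ₗ (toConv φ * toConv ψ).ofConv)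
      = toConv φ * toConv (mulRight k C ∘ₗ ψ) := by
  ext x
  simp [(ℛ k x).convMul_apply, Finset.sum_mul, mul_assoc]

/-- scalar-valued functional as an algebra valued one -/
noncomputable def scal (A : Type) [Ring A] [Algebra k A] (f : H →ₗ[k] k) : H →ₗ[k] A :=
  Algebra.linearMap k A ∘ₗ f

lemma comp_scal_left (C : A) (f : H →ₗ[k] k) (ψ : H →ₗ[k] A) :
    toConv (mulLeft k C ∘ₗ (toConv (scal A f) * toConv ψ).ofConv)
      = toConv (scal A f) * toConv (mulLeft k C ∘ₗ ψ) := by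
  ext x
  simp [(ℛ k x).convMul_apply, Finset.mul_sum, scal, ← Algebra.smul_def]

lemma comp_scal_right (C : A) (f : H →ₗ[k] k) (ψ : H →ₗ[k] A) :
    toConv (mulRight k C ∘ₗ (toConv ψ * toConv (scal A f)).ofConv)
      = toConv (mulRight k C ∘ₗ ψ) * toConv (scal A f) := by
  ext x
  simp [(ℛ k x).convMul_apply, Finset.sum_mul, scal, mul_assoc, Algebra.commutes]

lemma scal_counit : toConv (scal A (counit (R := k) (A := H))) = 1 := rfl

lemma scal_mul_inv (γ : H →ₐ[k] k) :
    toConv (scal A γ.toLinearMap) * toConv (scal A (γ.toLinearMap ∘ₗ antipode k)) = 1 := by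
  ext x
  have := congrArg (fun t => algebraMap k A (γ t)) (sum_mul_antipode_eq_algebraMap_counit (ℛ k x))
  simpa [(ℛ k x).convMul_apply, scal] using this

lemma scal_inv_mul (γ : H →ₐ[k] k) :
    toConv (scal A (γ.toLinearMap ∘ₗ antipode k)) * toConv (scal A γ.toLinearMap) = 1 := by
  ext x
  have := congrArg (fun t => algebraMap k A (γ t)) (sum_antipode_mul_eq_algebraMap_counit (ℛ k x))
  simpa [(ℛ k x).convMul_apply, scal] using this

end convgen

variable (k H) in
noncomputable def ii1 : H →ₗ[k] H ⊗[k] H := (TensorProduct.mk k H H).flip 1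
variable (k H) in
noncomputable def ii2 : H →ₗ[k] H ⊗[k] H := TensorProduct.mk k H H 1

lemma ii1_apply (x : H) : ii1 k H x = x ⊗ₜ 1 := rfl
lemma ii2_apply (x : H) : ii2 k H x = 1 ⊗ₜ x := rfl

lemma ii1_conv_ii2 : toConv (ii1 k H) * toConv (ii2 k H) = toConv (comul (R := k) (A := H)) := by
  ext x
  rw [(ℛ k x).convMul_apply]
  simp [ii1_apply, ii2_apply, (ℛ k x).eq]

lemma ii2_conv_S : toConv (ii2 k H) * toConv (ii2 k H ∘ₗ antipode k) = 1 := by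
  ext x
  have := congrArg (ii2 k H) (sum_mul_antipode_eq_algebraMap_counit (ℛ k x))
  simp [ii2_apply, Algebra.algebraMap_eq_smul_one] at this
  simp [(ℛ k x).convMul_apply, ii2_apply, Algebra.algebraMap_eq_smul_one,
    Algebra.TensorProduct.one_def, ← this, ← TensorProduct.tmul_sum]

lemma S_conv_ii1 : toConv (ii1 k H ∘ₗ antipode k) * toConv (ii1 k H) = 1 := by
  ext x
  have := congrArg (ii1 k H) (sum_antipode_mul_eq_algebraMap_counit (ℛ k x))
  simp [ii1_apply, Algebra.algebraMap_eq_smul_one] at this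
  simp [(ℛ k x).convMul_apply, ii1_apply, Algebra.algebraMap_eq_smul_one,
    Algebra.TensorProduct.one_def, ← this, ← TensorProduct.sum_tmul, TensorProduct.smul_tmul']

variable (k H) in
/-- `h ↦ f(h₁) h₂` -/
noncomputable def twL (f : H →ₗ[k] k) : H →ₗ[k] H :=
  (TensorProduct.lid k H).toLinearMap ∘ₗ rTensor H f ∘ₗ comul
variable (k H) in
/-- `h ↦ h₁ f(h₂)` -/
noncomputable def twR (f : H →ₗ[k] k) : H →ₗ[k] H :=
  (TensorProduct.rid k H).toLinearMap ∘ₗ lTensor H f ∘ₗ comul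

lemma twL_eq (f : H →ₗ[k] k) (x : H) :
    twL k H f x = ∑ i ∈ (ℛ k x).index, f ((ℛ k x).left i) • (ℛ k x).right i := by
  simp only [twL, comp_apply]
  conv_lhs => rw [← (ℛ k x).eq]
  simp

lemma twR_eq (f : H →ₗ[k] k) (x : H) :
    twR k H f x = ∑ i ∈ (ℛ k x).index, f ((ℛ k x).right i) • (ℛ k x).left i := by
  simp only [twR, comp_apply]
  conv_lhs => rw [← (ℛ k x).eq]
  simp

/-- `C (α x ⊗ 1) = C (1 ⊗ S x)` -/
lemma K1 (c : H) (γ : H →ₐ[k] k) (hγ : ∀ h : H, c * h = γ h • c) (x : H) :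
    comul (R := k) c * (twL k H (γ.toLinearMap ∘ₗ antipode k) x ⊗ₜ 1)
      = comul (R := k) c * (1 ⊗ₜ antipode k x) := by
  set C := comul (R := k) c
  set G' := scal (H ⊗[k] H) (γ.toLinearMap ∘ₗ antipode k)
  set G := scal (H ⊗[k] H) γ.toLinearMap
  have e1 : toConv (ii1 k H) = toConv comul * toConv (ii2 k H ∘ₗ antipode k) := by
    rw [← ii1_conv_ii2, mul_assoc, ii2_conv_S, mul_one]
  have e2 : mulLeft k C ∘ₗ comul = mulLeft k C ∘ₗ G := by
    ext h
    simp [C, G, scal, ← Bialgebra.comul_mul, hγ, Algebra.algebraMap_eq_smul_one]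
  have key : toConv (mulLeft k C ∘ₗ (toConv G' * toConv (ii1 k H)).ofConv)
      = toConv (mulLeft k C ∘ₗ (ii2 k H ∘ₗ antipode k)) := by
    rw [comp_scal_left]
    have : toConv (mulLeft k C ∘ₗ ii1 k H)
        = toConv (mulLeft k C ∘ₗ (toConv G * toConv (ii2 k H ∘ₗ antipode k)).ofConv) := by
      rw [comp_conv_left, ← e2, ← comp_conv_left, ← e1]
    rw [this, comp_scal_left, ← mul_assoc, scal_inv_mul, one_mul]
  have := congrArg (fun t => t.ofConv x) key
  simp only [LinearMap.comp_apply, mulLeft_apply] at this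
  change C * _ = C * _ at this
  rw [(ℛ k x).convMul_apply] at this
  rw [twL_eq]
  simpa [G', scal, ii1_apply, ii2_apply, TensorProduct.sum_tmul, TensorProduct.smul_tmul',
    ← Algebra.smul_def] using this

/-- `(1 ⊗ h) C = (S h ⊗ 1) C` -/
lemma K2 (c : H) (hc : ∀ h : H, h * c = (counit (R := k) h) • c) (x : H) :
    (1 ⊗ₜ x) * comul (R := k) c = (antipode k x ⊗ₜ 1) * comul (R := k) c := by
  set C := comul (R := k) c
  have e1 : toConv (ii2 k H) = toConv (ii1 k H ∘ₗ antipode k) * toConv comul := by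
    rw [← ii1_conv_ii2, ← mul_assoc, S_conv_ii1, one_mul]
  have e2 : mulRight k C ∘ₗ comul = mulRight k C ∘ₗ scal (H ⊗[k] H) (counit (R := k) (A := H)) := by
    ext h
    simp [C, scal, ← Bialgebra.comul_mul, hc, Algebra.algebraMap_eq_smul_one]
  have key : toConv (mulRight k C ∘ₗ ii2 k H)
      = toConv (mulRight k C ∘ₗ (ii1 k H ∘ₗ antipode k)) := by
    have : ii2 k H = (toConv (ii1 k H ∘ₗ antipode k) * toConv comul).ofConv := by rw [← e1]
    rw [this, comp_conv_right, e2, ← comp_conv_right, scal_counit, mul_one]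
  have := congrArg (fun t => t.ofConv x) key
  simpa [ii1_apply, ii2_apply] using this

lemma sum_Sinv (Sinv : H →ₗ[k] H)
    (hSinv₁ : ∀ x : H, Sinv (antipode k x) = x) (hSinv₂ : ∀ x : H, antipode k (Sinv x) = x)
    {x : H} {ι : Type*} (r : Coalgebra.Repr k x ι) :
    ∑ i ∈ r.index, r.right i * Sinv (r.left i) = algebraMap k H (counit x) := by
  have hinj : Function.Injective (antipode k (A := H)) := Function.LeftInverse.injective hSinv₁
  apply hinj
  simp only [map_sum, antipode_mul_antidistrib, hSinv₂]
  rw [sum_mul_antipode_eq_algebraMap_counit]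
  simp [Algebra.algebraMap_eq_smul_one]

/-- `C (1 ⊗ α' x) = C (S⁻¹ x ⊗ 1)` -/
lemma K1' (Sinv : H →ₗ[k] H)
    (hSinv₁ : ∀ x : H, Sinv (antipode k x) = x) (hSinv₂ : ∀ x : H, antipode k (Sinv x) = x)
    (c : H) (γ : H →ₐ[k] k) (hγ : ∀ h : H, c * h = γ h • c) (x : H) :
    comul (R := k) c * (1 ⊗ₜ twR k H (γ.toLinearMap ∘ₗ antipode k) x)
      = comul (R := k) c * (Sinv x ⊗ₜ 1) := by
  set C := comul (R := k) c
  set o : H ⊗[k] H →ₗ[k] (H ⊗[k] H)ᵐᵒᵖ := (opLinearEquiv k).toLinearMap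
  set G' := scal (H ⊗[k] H)ᵐᵒᵖ (γ.toLinearMap ∘ₗ antipode k)
  set G := scal (H ⊗[k] H)ᵐᵒᵖ γ.toLinearMap
  have e0 : toConv (o ∘ₗ comul) = toConv (o ∘ₗ ii1 k H) * toConv (o ∘ₗ ii2 k H) := by
    ext h
    rw [(ℛ k h).convMul_apply]
    simp [ii1_apply, ii2_apply, o, ← op_mul, ← (ℛ k h).eq]
  have e00 : toConv (o ∘ₗ ii1 k H ∘ₗ Sinv) * toConv (o ∘ₗ ii1 k H) = 1 := by
    ext h
    have := congrArg (fun t => op (ii1 k H t)) (sum_Sinv Sinv hSinv₁ hSinv₂ (ℛ k h))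
    rw [(ℛ k h).convMul_apply]
    simp [ii1_apply, Algebra.algebraMap_eq_smul_one, TensorProduct.sum_tmul] at this
    simp [o, ii1_apply, ← op_mul, this, Algebra.algebraMap_eq_smul_one]
    rfl
  have e1 : toConv (o ∘ₗ ii2 k H) = toConv (o ∘ₗ ii1 k H ∘ₗ Sinv) * toConv (o ∘ₗ comul) := by
    rw [e0, ← mul_assoc, e00, one_mul]
  have e2 : mulRight k (op C) ∘ₗ (o ∘ₗ comul) = mulRight k (op C) ∘ₗ G := by
    ext h
    simp [C, G, o, scal, ← op_mul, ← Bialgebra.comul_mul, hγ, Algebra.algebraMap_eq_smul_one]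
  have key : toConv (mulRight k (op C) ∘ₗ (toConv (o ∘ₗ ii2 k H) * toConv G').ofConv)
      = toConv (mulRight k (op C) ∘ₗ (o ∘ₗ ii1 k H ∘ₗ Sinv)) := by
    rw [comp_scal_right]
    have : toConv (mulRight k (op C) ∘ₗ (o ∘ₗ ii2 k H))
        = toConv (o ∘ₗ ii1 k H ∘ₗ Sinv) * toConv (mulRight k (op C) ∘ₗ G) := by
      rw [← e2, ← comp_conv_right, ← e1]
    rw [this, mul_assoc, ← comp_scal_right, scal_mul_inv, ← comp_conv_right, mul_one]
  have := congrArg (fun t => unop (t.ofConv x)) key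
  simp only [LinearMap.comp_apply, mulRight_apply, unop_mul, unop_op] at this
  change C * unop _ = C * _ at this
  rw [(ℛ k x).convMul_apply] at this
  rw [twR_eq]
  simpa [G', scal, ii1_apply, ii2_apply, o, TensorProduct.tmul_sum, TensorProduct.tmul_smul,
    ← Algebra.commutes, ← Algebra.smul_def, Algebra.algebraMap_eq_smul_one,
    TensorProduct.smul_tmul'] using this

variable (k H) in
/-- `(φ ⊗ id)` -/
noncomputable def cL (φ : H →ₗ[k] k) : H ⊗[k] H →ₗ[k] H :=
  (TensorProduct.lid k H).toLinearMap ∘ₗ rTensor H φ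
variable (k H) in
/-- `(id ⊗ φ)` -/
noncomputable def cR (φ : H →ₗ[k] k) : H ⊗[k] H →ₗ[k] H :=
  (TensorProduct.rid k H).toLinearMap ∘ₗ lTensor H φ

@[simp] lemma cL_tmul (φ : H →ₗ[k] k) (a b : H) : cL k H φ (a ⊗ₜ b) = φ a • b := by simp [cL]
@[simp] lemma cR_tmul (φ : H →ₗ[k] k) (a b : H) : cR k H φ (a ⊗ₜ b) = φ b • a := by simp [cR]

lemma cL_mul_left (φ : H →ₗ[k] k) (a b : H) (t : H ⊗[k] H) :
    cL k H φ ((a ⊗ₜ b) * t) = b * cL k H (φ ∘ₗ mulLeft k a) t := by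
  induction t with
  | zero => simp
  | tmul x y => simp
  | add x y hx hy => simp [mul_add, hx, hy]

lemma cL_mul_right (φ : H →ₗ[k] k) (a b : H) (t : H ⊗[k] H) :
    cL k H φ (t * (a ⊗ₜ b)) = cL k H (φ ∘ₗ mulRight k a) t * b := by
  induction t with
  | zero => simp
  | tmul x y => simp
  | add x y hx hy => simp [add_mul, hx, hy]

lemma cR_mul_left (φ : H →ₗ[k] k) (a b : H) (t : H ⊗[k] H) :
    cR k H φ ((a ⊗ₜ b) * t) = a * cR k H (φ ∘ₗ mulLeft k b) t := by
  induction t with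
  | zero => simp
  | tmul x y => simp
  | add x y hx hy => simp [mul_add, hx, hy]

lemma cR_mul_right (φ : H →ₗ[k] k) (a b : H) (t : H ⊗[k] H) :
    cR k H φ (t * (a ⊗ₜ b)) = cR k H (φ ∘ₗ mulRight k b) t * a := by
  induction t with
  | zero => simp
  | tmul x y => simp
  | add x y hx hy => simp [add_mul, hx, hy]

lemma cL_cR (φ f : H →ₗ[k] k) (t : H ⊗[k] H) : f (cL k H φ t) = φ (cR k H f t) := by
  induction t with
  | zero => simp
  | tmul x y => simp [mul_comm]
  | add x y hx hy => simp [hx, hy]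

lemma mulLeft_one' : mulLeft k (1 : H) = LinearMap.id := by ext; simp
lemma mulRight_one' : mulRight k (1 : H) = LinearMap.id := by ext; simp

variable (k H) in
noncomputable def TT (t : H ⊗[k] H) : Module.Dual k H →ₗ[k] H where
  toFun φ := cL k H φ t
  map_add' φ ψ := by simp [cL, rTensor_add]
  map_smul' a φ := by simp [cL, rTensor_smul]

lemma TT_apply (t : H ⊗[k] H) (φ : Module.Dual k H) : TT k H t φ = cL k H φ t := rfl

lemma TT_surj [FiniteDimensional k H] (c : H) (hc_ne : c ≠ 0)
    (hc : ∀ h : H, h * c = (counit (R := k) h) • c) :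
    Function.Surjective (TT k H (comul (R := k) c)) := by
  set C := comul (R := k) c with hC
  have hideal : ∀ (h : H) (φ : H →ₗ[k] k),
      h * cL k H φ C = cL k H (φ ∘ₗ mulLeft k (antipode k h)) C := by
    intro h φ
    have := congrArg (cL k H φ) (K2 c hc h)
    rw [cL_mul_left, cL_mul_left, mulLeft_one', one_mul] at this
    simpa using this
  obtain ⟨φ, hφ⟩ : ∃ φ : Module.Dual k H, φ c ≠ 0 := by
    by_contra! hh
    exact hc_ne ((Module.forall_dual_apply_eq_zero_iff k c).1 hh)
  let ψ : H →ₗ[k] H := (toConv (scal H φ) * toConv (antipode k)).ofConv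
  have h1 : mul' k H (map ψ LinearMap.id C) = φ c • 1 := by
    have : toConv (scal H φ) * toConv (antipode k) * toConv LinearMap.id = toConv (scal H φ) := by
      rw [mul_assoc, antipode_mul_id, mul_one]
    have := congrArg (fun t => t.ofConv c) this
    simpa [scal, Algebra.algebraMap_eq_smul_one] using! this
  let b := Module.finBasis k H
  have h2 : ∀ t : H ⊗[k] H, mul' k H (map ψ LinearMap.id t)
      = ∑ j, b j * cL k H (b.coord j ∘ₗ ψ) t := by
    intro t
    induction t with
    | zero => simp
    | tmul x y =>
      conv_lhs => rw [map_tmul, mul'_apply, ← b.sum_repr (ψ x), Finset.sum_mul]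
      simp
    | add x y hx hy => simp only [map_add, mul_add, Finset.sum_add_distrib, hx, hy]
  have h3 : (1 : H) ∈ LinearMap.range (TT k H C) := by
    have : (φ c)⁻¹ • (φ c • (1 : H)) ∈ LinearMap.range (TT k H C) := by
      apply Submodule.smul_mem
      rw [← h1, h2]
      apply Submodule.sum_mem
      intro j _
      rw [hideal]
      exact ⟨_, rfl⟩
    simpa [smul_smul, hφ] using this
  intro x
  obtain ⟨χ, hχ⟩ := h3
  refine ⟨χ ∘ₗ mulLeft k (antipode k x), ?_⟩
  rw [TT_apply, ← hideal, ← TT_apply, hχ, mul_one]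

lemma TT_inj [FiniteDimensional k H] (c : H) (hc_ne : c ≠ 0)
    (hc : ∀ h : H, h * c = (counit (R := k) h) • c) :
    Function.Injective (TT k H (comul (R := k) c)) :=
  (LinearMap.injective_iff_surjective_of_finrank_eq_finrank Subspace.dual_finrank_eq).2
    (TT_surj c hc_ne hc)

lemma pivot_S (Sinv : H →ₗ[k] H) (hSinv₂ : ∀ x : H, antipode k (Sinv x) = x)
    (g ginv : H) (hg_pivot : ∀ a : H, antipode k (antipode k a) = g * a * ginv) (h : H) :
    antipode k h = g * Sinv h * ginv := by
  rw [← hg_pivot, hSinv₂]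

lemma swap1 [FiniteDimensional k H] (Sinv : H →ₗ[k] H)
    (hSinv₁ : ∀ x : H, Sinv (antipode k x) = x) (hSinv₂ : ∀ x : H, antipode k (Sinv x) = x)
    (g ginv : H) (hg₂ : ginv * g = 1)
    (hg_pivot : ∀ a : H, antipode k (antipode k a) = g * a * ginv)
    (c : H) (hc_ne : c ≠ 0) (hc : ∀ h : H, h * c = (counit (R := k) h) • c)
    (γ : H →ₐ[k] k) (hγ : ∀ h : H, c * h = γ h • c)
    (lam : H →ₗ[k] k) (hl : ∀ h : H, cL k H lam (comul (R := k) h) = lam h • ginv) (h b : H) :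
    lam (h * b) = lam (b * twL k H (γ.toLinearMap ∘ₗ antipode k) h) := by
  have e : lam ∘ₗ mulLeft k h
      = lam ∘ₗ mulRight k (twL k H (γ.toLinearMap ∘ₗ antipode k) h) := by
    apply TT_inj c hc_ne hc
    rw [TT_apply, TT_apply]
    have a1 := congrArg (cL k H lam) (K2 c hc (Sinv h))
    rw [cL_mul_left, cL_mul_left, hSinv₂, mulLeft_one', one_mul, LinearMap.comp_id, hl] at a1
    have a2 := congrArg (cL k H lam) (K1 c γ hγ h)
    rw [cL_mul_right, cL_mul_right, mulRight_one', mul_one, LinearMap.comp_id, hl] at a2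
    rw [← a1, a2, pivot_S Sinv hSinv₂ g ginv hg_pivot h]
    simp [← mul_assoc, hg₂]
  exact LinearMap.congr_fun e b

lemma swap2 [FiniteDimensional k H] (Sinv : H →ₗ[k] H)
    (hSinv₁ : ∀ x : H, Sinv (antipode k x) = x) (hSinv₂ : ∀ x : H, antipode k (Sinv x) = x)
    (g ginv : H) (hg₂ : ginv * g = 1)
    (hg_pivot : ∀ a : H, antipode k (antipode k a) = g * a * ginv)
    (c : H) (hc_ne : c ≠ 0) (hc : ∀ h : H, h * c = (counit (R := k) h) • c)
    (γ : H →ₐ[k] k) (hγ : ∀ h : H, c * h = γ h • c)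
    (lam : H →ₗ[k] k) (hl : ∀ h : H, cR k H lam (comul (R := k) h) = lam h • g) (h b : H) :
    lam (h * b) = lam (b * twR k H (γ.toLinearMap ∘ₗ antipode k) h) := by
  have e : cR k H (lam ∘ₗ mulLeft k h) (comul (R := k) c)
      = cR k H (lam ∘ₗ mulRight k (twR k H (γ.toLinearMap ∘ₗ antipode k) h))
          (comul (R := k) c) := by
    have a1 := congrArg (cR k H lam) (K2 c hc h)
    rw [cR_mul_left, cR_mul_left, mulLeft_one', one_mul, LinearMap.comp_id, hl] at a1
    have a2 := congrArg (cR k H lam) (K1' Sinv hSinv₁ hSinv₂ c γ hγ h)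
    rw [cR_mul_right, cR_mul_right, mulRight_one', mul_one, LinearMap.comp_id, hl] at a2
    rw [a1, a2, pivot_S Sinv hSinv₂ g ginv hg_pivot h]
    simp [mul_assoc, hg₂]
  obtain ⟨φ, rfl⟩ := TT_surj c hc_ne hc b
  have := congrArg φ e
  rw [← cL_cR, ← cL_cR] at this
  exact this

lemma twist13_eq (S1 : H →ₗ[k] H) (f : H →ₗ[k] k) (a h : H) :
    twistAct13 k H S1 f a h
      = ∑ i ∈ (ℛ k h).index, S1 ((ℛ k h).left i) * a * twL k H f ((ℛ k h).right i) := by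
  have e : ∀ (x : H) (t : H ⊗[k] H), (LinearMap.mul' k H)
    ((LinearMap.rTensor H ((LinearMap.mulRight k a).comp S1))
      ((LinearMap.rTensor H
          ((TensorProduct.rid k H).toLinearMap.comp (LinearMap.lTensor H f)))
        ((TensorProduct.assoc k H H H).symm (x ⊗ₜ t)))) = S1 x * a * cL k H f t := by
    intro x t
    induction t with
    | zero => simp
    | tmul y z => simp
    | add y z hy hz => simp only [tmul_add, map_add, mul_add, hy, hz]
  unfold twistAct13 sweedler3
  rw [← Coalgebra.coassoc_symm_apply]
  conv_lhs => rw [← (ℛ k h).eq]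
  simp only [map_sum, lTensor_tmul, e]
  rfl

lemma twist31_eq (S1 : H →ₗ[k] H) (f : H →ₗ[k] k) (a h : H) :
    twistAct31 k H S1 f a h
      = ∑ i ∈ (ℛ k h).index, S1 ((ℛ k h).right i) * a * twR k H f ((ℛ k h).left i) := by
  unfold twistAct31 sweedler3
  conv_lhs => rw [← (ℛ k h).eq]
  simp only [map_sum, rTensor_tmul, TensorProduct.comm_tmul, mul'_apply]
  rfl

end helpers

theorem stmt_9
    (k : Type) [Field k] [IsAlgClosed k]
    (H : Type) [Ring H] [HopfAlgebra k H] [FiniteDimensional k H]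
    -- inverse of the antipode
    (Sinv : H →ₗ[k] H)
    (hSinv₁ : ∀ x : H, Sinv (HopfAlgebra.antipode (R := k) x) = x)
    (hSinv₂ : ∀ x : H, HopfAlgebra.antipode (R := k) (Sinv x) = x)
    -- pivot: a group-like element `g` with `S²(a) = g a g⁻¹`
    (g ginv : H) (hg₁ : g * ginv = 1) (hg₂ : ginv * g = 1)
    (hg_grouplike : Coalgebra.comul (R := k) g = g ⊗ₜ[k] g)
    (hg_counit : Coalgebra.counit (R := k) g = (1 : k))
    (hg_pivot : ∀ a : H,
      HopfAlgebra.antipode (R := k) (HopfAlgebra.antipode (R := k) a) = g * a * ginv)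
    -- `c` is a non-zero left integral and `γ` the modulus of `H`
    (c : H) (hc_ne : c ≠ 0)
    (hc_left_integral : ∀ h : H, h * c = (Coalgebra.counit (R := k) h) • c)
    (γ : H →ₐ[k] k) (hγ : ∀ h : H, c * h = γ h • c)
    (lam : H →ₗ[k] k) :
    -- Part 1: right D-symmetrised monadic cointegral for A₁ ↔ right γ-symmetrised cointegral
    (((∀ a h : H,
          lam (twistAct13 k H Sinv
                (γ.toLinearMap.comp (HopfAlgebra.antipode (R := k))) a h)
            = (Coalgebra.counit (R := k) h) * lam a) ∧
        (∀ (f : Module.Dual k H) (x : H),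
          (TensorProduct.lid k k) ((TensorProduct.map lam f) (Coalgebra.comul (R := k) x))
            = f ginv * lam x))
      ↔ (∀ h : H,
          (TensorProduct.lid k H)
            ((LinearMap.rTensor H lam) (Coalgebra.comul (R := k) h)) = lam h • ginv))
    ∧
    -- Part 2: left D-symmetrised monadic cointegral for A₄ ↔ left γ-symmetrised cointegral
    (((∀ a h : H,
          lam (twistAct31 k H (HopfAlgebra.antipode (R := k))
                (γ.toLinearMap.comp (HopfAlgebra.antipode (R := k))) a h)
            = (Coalgebra.counit (R := k) h) * lam a) ∧
        (∀ (f : Module.Dual k H) (x : H),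
          (TensorProduct.lid k k) ((TensorProduct.map f lam) (Coalgebra.comul (R := k) x))
            = f g * lam x))
      ↔ (∀ h : H,
          (TensorProduct.rid k H)
            ((LinearMap.lTensor H lam) (Coalgebra.comul (R := k) h)) = lam h • g)) := by
  constructor
  · constructor
    · rintro ⟨-, h2⟩ h
      rw [← sub_eq_zero, ← Module.forall_dual_apply_eq_zero_iff k]
      intro f
      have := h2 f h
      rw [map_sub, sub_eq_zero, map_smul, smul_eq_mul, mul_comm, ← this]
      generalize Coalgebra.comul (R := k) h = t
      induction t with
      | zero => simp
      | tmul x y => simp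
      | add x y hx hy => simp only [map_add, hx, hy]
    · intro hl
      refine ⟨?_, ?_⟩
      · intro a h
        rw [twist13_eq, map_sum]
        simp only [← swap1 Sinv hSinv₁ hSinv₂ g ginv hg₂ hg_pivot c hc_ne hc_left_integral γ hγ
          lam hl, ← mul_assoc]
        rw [← map_sum, ← Finset.sum_mul, sum_Sinv Sinv hSinv₁ hSinv₂]
        simp [Algebra.algebraMap_eq_smul_one]
      · intro f x
        have := congrArg f (hl x)
        rw [map_smul, smul_eq_mul, mul_comm] at this
        rw [← this]
        generalize Coalgebra.comul (R := k) x = t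
        induction t with
        | zero => simp
        | tmul x y => simp
        | add x y hx hy => simp only [map_add, hx, hy]
  · constructor
    · rintro ⟨-, h2⟩ h
      rw [← sub_eq_zero, ← Module.forall_dual_apply_eq_zero_iff k]
      intro f
      have := h2 f h
      rw [map_sub, sub_eq_zero, map_smul, smul_eq_mul, mul_comm, ← this]
      generalize Coalgebra.comul (R := k) h = t
      induction t with
      | zero => simp
      | tmul x y => simp [mul_comm]
      | add x y hx hy => simp only [map_add, hx, hy]
    · intro hl
      refine ⟨?_, ?_⟩
      · intro a h
        rw [twist31_eq, map_sum]
        simp only [← swap2 Sinv hSinv₁ hSinv₂ g ginv hg₂ hg_pivot c hc_ne hc_left_integral γ hγ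
          lam hl, ← mul_assoc]
        rw [← map_sum, ← Finset.sum_mul, sum_mul_antipode_eq_algebraMap_counit]
        simp [Algebra.algebraMap_eq_smul_one]
      · intro f x
        have := congrArg f (hl x)
        rw [map_smul, smul_eq_mul, mul_comm] at this
        rw [← this]
        generalize Coalgebra.comul (R := k) x = t
        induction t with
        | zero => simp
        | tmul x y => simp [mul_comm]
        | add x y hx hy => simp only [map_add, hx, hy]
end
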